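/- arXiv:1102.3018 — 5 statements merged into one kernel-verified Lean document; each statement's English description precedes it below -/
import Mathlib

section
/- Let a > 0, r > 0 and ε ∈ [0, 2a] be real numbers. Suppose f : [0, r] → ℝ satisfies |f(s) - f(t)| ≤ a|s - t| for all s, t ∈ [0, r], f(0) = 0, and f(r) ≥ (-a + ε)r. Then ∫₀^r (f(t) - f(r)) dt ≤ (r²/2)(a - ε²/(2a)). -/
/-- Key integral estimate in the proof of the f-mean curvature comparison theorem:
if `f` is `a`-Lipschitz on `[0, r]`, `f 0 = 0` and `f r ≥ (-a + ε) r`, then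
`∫₀ʳ (f t - f r) dt ≤ (r²/2)(a - ε²/(2a))`. -/
theorem integral_estimate_steady
    (a r ε : ℝ) (ha : 0 < a) (hr : 0 < r) (hε : ε ∈ Set.Icc 0 (2 * a))
    (f : ℝ → ℝ)
    (hLip : ∀ s ∈ Set.Icc (0:ℝ) r, ∀ t ∈ Set.Icc (0:ℝ) r, |f s - f t| ≤ a * |s - t|)
    (hf0 : f 0 = 0) (hfr : (-a + ε) * r ≤ f r) :
    ∫ t in (0:ℝ)..r, (f t - f r) ≤ r ^ 2 / 2 * (a - ε ^ 2 / (2 * a)) := by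
  obtain ⟨hε0, hε1⟩ := hε
  obtain ⟨c, hc⟩ : ∃ c, c = ε * r / (2 * a) := ⟨_, rfl⟩
  have hca : 2 * a * c = ε * r := by rw [hc]; field_simp
  have hc0 : 0 ≤ c := by rw [hc]; positivity
  have hcr : c ≤ r := by
    rw [hc, div_le_iff₀ (by positivity)]
    nlinarith
  have hcont : ContinuousOn f (Set.Icc 0 r) := by
    have h : LipschitzOnWith (Real.toNNReal a) f (Set.Icc 0 r) := by
      refine LipschitzOnWith.of_dist_le_mul ?_
      intro x hx y hy
      rw [Real.dist_eq, Real.dist_eq, Real.coe_toNNReal a ha.le]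
      exact hLip x hx y hy
    exact h.continuousOn
  have hcont' : ContinuousOn (fun t => f t - f r) (Set.Icc 0 r) := hcont.sub continuousOn_const
  have hi1 : IntervalIntegrable (fun t => f t - f r) MeasureTheory.volume 0 c :=
    (hcont'.mono (Set.Icc_subset_Icc_right hcr)).intervalIntegrable_of_Icc hc0
  have hi2 : IntervalIntegrable (fun t => f t - f r) MeasureTheory.volume c r :=
    (hcont'.mono (Set.Icc_subset_Icc_left hc0)).intervalIntegrable_of_Icc hcr
  have h1 : ∫ t in (0:ℝ)..c, (f t - f r) ≤ ∫ t in (0:ℝ)..c, (a * t + (a - ε) * r) := by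
    refine intervalIntegral.integral_mono_on hc0 hi1
      (Continuous.intervalIntegrable (by fun_prop) _ _) ?_
    intro t ht
    have h := hLip t ⟨ht.1, ht.2.trans hcr⟩ 0 ⟨le_rfl, hr.le⟩
    rw [hf0, sub_zero, sub_zero, abs_of_nonneg ht.1] at h
    linarith [le_abs_self (f t)]
  have h2 : ∫ t in c..r, (f t - f r) ≤ ∫ t in c..r, (a * r - a * t) := by
    refine intervalIntegral.integral_mono_on hcr hi2
      (Continuous.intervalIntegrable (by fun_prop) _ _) ?_
    intro t ht
    have h := hLip t ⟨hc0.trans ht.1, ht.2⟩ r ⟨hr.le, le_rfl⟩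
    rw [abs_of_nonpos (by linarith [ht.2] : t - r ≤ 0)] at h
    linarith [le_abs_self (f t - f r)]
  have e1 : ∫ t in (0:ℝ)..c, (a * t + (a - ε) * r) = a * (c ^ 2 / 2) + (a - ε) * r * c := by
    rw [intervalIntegral.integral_add (Continuous.intervalIntegrable (by fun_prop) _ _)
      (Continuous.intervalIntegrable (by fun_prop) _ _), intervalIntegral.integral_const_mul,
      integral_id, intervalIntegral.integral_const, smul_eq_mul]
    ring
  have e2 : ∫ t in c..r, (a * r - a * t) = a * r * (r - c) - a * ((r ^ 2 - c ^ 2) / 2) := by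
    rw [intervalIntegral.integral_sub (Continuous.intervalIntegrable (by fun_prop) _ _)
      (Continuous.intervalIntegrable (by fun_prop) _ _), intervalIntegral.integral_const,
      intervalIntegral.integral_const_mul, integral_id, smul_eq_mul]
    ring
  rw [← intervalIntegral.integral_add_adjacent_intervals hi1 hi2]
  rw [e1] at h1
  rw [e2] at h2
  refine (add_le_add h1 h2).trans (le_of_eq ?_)
  rw [hc]
  field_simp
  ring
end

section
/- Let a > 0, r > 0 and ε ∈ [0, a] be real numbers. Suppose f : [0, r] → ℝ satisfies |f(s) - f(t)| ≤ a|s - t| for all s, t ∈ [0, r], f(0) = 0, f(t) ≤ 0 for all t ∈ [0, r], and f(r) ≥ (-a + ε)r. Then ∫₀^r (f(t) - f(r)) dt ≤ (r²/2)(a - ε²/a). -/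
/-- Improved integral estimate for rectifiable gradient steady Ricci solitons:
if `f` is `a`-Lipschitz on `[0, r]`, `f 0 = 0`, `f ≤ 0` on `[0, r]` and
`f r ≥ (-a + ε) r`, then `∫₀ʳ (f t - f r) dt ≤ (r²/2)(a - ε²/a)`. -/
theorem integral_estimate_rectifiable
    (a r ε : ℝ) (ha : 0 < a) (hr : 0 < r) (hε : ε ∈ Set.Icc 0 a)
    (f : ℝ → ℝ)
    (hLip : ∀ s ∈ Set.Icc (0:ℝ) r, ∀ t ∈ Set.Icc (0:ℝ) r, |f s - f t| ≤ a * |s - t|)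
    (hf0 : f 0 = 0) (hnonpos : ∀ t ∈ Set.Icc (0:ℝ) r, f t ≤ 0)
    (hfr : (-a + ε) * r ≤ f r) :
    ∫ t in (0:ℝ)..r, (f t - f r) ≤ r ^ 2 / 2 * (a - ε ^ 2 / a) := by
  obtain ⟨hε0, hεa⟩ := hε
  have hcont : ContinuousOn f (Set.Icc 0 r) := by
    have : LipschitzOnWith (Real.toNNReal a) f (Set.Icc 0 r) := by
      apply LipschitzOnWith.of_dist_le_mul
      intro x hx y hy
      rw [Real.dist_eq, Real.dist_eq, Real.coe_toNNReal a ha.le]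
      exact hLip x hx y hy
    exact this.continuousOn
  have hg : ContinuousOn (fun t => f t - f r) (Set.Icc 0 r) := hcont.sub continuousOn_const
  obtain ⟨c, hc⟩ : ∃ c, c = ε * r / a := ⟨_, rfl⟩
  have hca : a * c = ε * r := by rw [hc]; field_simp
  have hc0 : 0 ≤ c := by rw [hc]; positivity
  have hcr : c ≤ r := by
    rw [hc, div_le_iff₀ ha]; nlinarith
  have hi1 : IntervalIntegrable (fun t => f t - f r) MeasureTheory.volume 0 c :=
    (hg.mono (Set.Icc_subset_Icc le_rfl hcr)).intervalIntegrable_of_Icc hc0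
  have hi2 : IntervalIntegrable (fun t => f t - f r) MeasureTheory.volume c r :=
    (hg.mono (Set.Icc_subset_Icc hc0 le_rfl)).intervalIntegrable_of_Icc hcr
  rw [← intervalIntegral.integral_add_adjacent_intervals hi1 hi2]
  have h1 : ∫ t in (0:ℝ)..c, (f t - f r) ≤ ∫ t in (0:ℝ)..c, (a - ε) * r := by
    apply intervalIntegral.integral_mono_on hc0 hi1 (by simp)
    intro t ht
    have := hnonpos t ⟨ht.1, ht.2.trans hcr⟩
    linarith
  have h2 : ∫ t in c..r, (f t - f r) ≤ ∫ t in c..r, (a * r - a * t) := by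
    apply intervalIntegral.integral_mono_on hcr hi2
      ((by fun_prop : Continuous fun t : ℝ => a * r - a * t).intervalIntegrable _ _)
    intro t ht
    have := hLip t ⟨hc0.trans ht.1, ht.2⟩ r ⟨hr.le, le_rfl⟩
    rw [abs_of_nonpos (sub_nonpos.2 ht.2)] at this
    have := (le_abs_self _).trans this
    linarith
  have h3 : ∫ t in (0:ℝ)..c, (a - ε) * r = c * ((a - ε) * r) := by
    rw [intervalIntegral.integral_const, smul_eq_mul, sub_zero]
  have h4 : ∫ t in c..r, (a * r - a * t) = (r - c) * (a * r) - a * ((r ^ 2 - c ^ 2) / 2) := by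
    rw [intervalIntegral.integral_sub (by simp)
      ((by fun_prop : Continuous fun t : ℝ => a * t).intervalIntegrable _ _),
      intervalIntegral.integral_const, smul_eq_mul,
      intervalIntegral.integral_const_mul, integral_id]
  rw [h3] at h1
  rw [h4] at h2
  refine (add_le_add h1 h2).trans (le_of_eq ?_)
  rw [hc]
  field_simp
  ring
end

section
/- Let n ≥ 1, a > 0, r > 0, ε ∈ [0, 2a] be real numbers, and let f : [0, r] → ℝ satisfy |f(s) - f(t)| ≤ a|s - t| for all s, t ∈ [0, r], f(0) = 0, and f(r) ≥ (-a + ε)r. If a real number m satisfies m ≤ (n-1)/r - (2/r)·f(r) + (2/r²)·∫₀^r f(t) dt, then m ≤ (a - ε²/(2a)) + (n-1)/r. -/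
/-- Analytic content of the f-mean curvature comparison theorem (Theorem 2.5):
if `m ≤ (n-1)/r - (2/r) f r + (2/r²) ∫₀ʳ f t dt` for an `a`-Lipschitz function `f`
with `f 0 = 0` and `f r ≥ (-a + ε) r`, then `m ≤ (a - ε²/(2a)) + (n-1)/r`. -/
theorem mean_curvature_comparison
    (n a r ε : ℝ) (hn : 1 ≤ n) (ha : 0 < a) (hr : 0 < r)
    (hε : ε ∈ Set.Icc 0 (2 * a))
    (f : ℝ → ℝ)
    (hLip : ∀ s ∈ Set.Icc (0:ℝ) r, ∀ t ∈ Set.Icc (0:ℝ) r, |f s - f t| ≤ a * |s - t|)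
    (hf0 : f 0 = 0) (hfr : (-a + ε) * r ≤ f r)
    (m : ℝ)
    (hm : m ≤ (n - 1) / r - (2 / r) * f r + (2 / r ^ 2) * ∫ t in (0:ℝ)..r, f t) :
    m ≤ (a - ε ^ 2 / (2 * a)) + (n - 1) / r := by
  obtain ⟨hε0, hε2⟩ := hε
  obtain ⟨c, hc⟩ : ∃ c, f r = 2 * a * c - a * r :=
    ⟨(f r + a * r) / (2 * a), by field_simp; ring⟩
  have h0m : (0:ℝ) ∈ Set.Icc (0:ℝ) r := ⟨le_rfl, hr.le⟩
  have hrm : r ∈ Set.Icc (0:ℝ) r := ⟨hr.le, le_rfl⟩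
  have hεc : ε * r ≤ 2 * a * c := by linarith
  have hc0 : 0 ≤ c := by
    have : 0 ≤ 2 * a * c := le_trans (by positivity) hεc
    exact nonneg_of_mul_nonneg_right this (by positivity)
  have hcr : c ≤ r := by
    have h := hLip r hrm 0 h0m
    rw [hf0, sub_zero, sub_zero, abs_of_pos hr] at h
    have h2 := (abs_le.1 h).2
    have : a * c ≤ a * r := by linarith
    exact le_of_mul_le_mul_left this ha
  have hcont : ContinuousOn f (Set.Icc 0 r) := by
    have : LipschitzOnWith (Real.toNNReal a) f (Set.Icc 0 r) := by
      apply LipschitzOnWith.of_dist_le_mul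
      intro x hx y hy
      rw [Real.dist_eq, Real.dist_eq, Real.coe_toNNReal a ha.le]
      exact hLip x hx y hy
    exact this.continuousOn
  have hi1 : IntervalIntegrable f MeasureTheory.volume 0 c := by
    apply ContinuousOn.intervalIntegrable
    rw [Set.uIcc_of_le hc0]
    exact hcont.mono (Set.Icc_subset_Icc le_rfl hcr)
  have hi2 : IntervalIntegrable f MeasureTheory.volume c r := by
    apply ContinuousOn.intervalIntegrable
    rw [Set.uIcc_of_le hcr]
    exact hcont.mono (Set.Icc_subset_Icc hc0 le_rfl)
  have h1 : ∫ t in (0:ℝ)..c, f t ≤ ∫ t in (0:ℝ)..c, a * t := by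
    apply intervalIntegral.integral_mono_on hc0 hi1
      ((by fun_prop : Continuous fun t : ℝ => a * t).intervalIntegrable _ _)
    intro t ht
    have h := hLip t ⟨ht.1, ht.2.trans hcr⟩ 0 h0m
    rw [hf0, sub_zero, sub_zero, abs_of_nonneg ht.1] at h
    exact (abs_le.1 h).2
  have h2 : ∫ t in c..r, f t ≤ ∫ t in c..r, (2 * a * c - a * t) := by
    apply intervalIntegral.integral_mono_on hcr hi2
      ((by fun_prop : Continuous fun t : ℝ => 2 * a * c - a * t).intervalIntegrable _ _)
    intro t ht
    have h := hLip r hrm t ⟨hc0.trans ht.1, ht.2⟩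
    rw [abs_of_nonneg (sub_nonneg.2 ht.2)] at h
    have := (abs_le.1 h).1
    linarith
  have e1 : ∫ t in (0:ℝ)..c, a * t = a * c ^ 2 / 2 := by
    rw [intervalIntegral.integral_const_mul, integral_id]; ring
  have e2 : ∫ t in c..r, (2 * a * c - a * t)
      = 2 * a * c * (r - c) - a * (r ^ 2 - c ^ 2) / 2 := by
    rw [intervalIntegral.integral_sub (by simp)
      ((by fun_prop : Continuous fun t : ℝ => a * t).intervalIntegrable _ _),
      intervalIntegral.integral_const, intervalIntegral.integral_const_mul, integral_id,
      smul_eq_mul]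
    ring
  have hI : ∫ t in (0:ℝ)..r, f t ≤ -a * c ^ 2 + 2 * a * c * r - a * r ^ 2 / 2 := by
    rw [← intervalIntegral.integral_add_adjacent_intervals hi1 hi2]
    rw [e1] at h1
    rw [e2] at h2
    linarith
  have hI2 := mul_le_mul_of_nonneg_left hI (by positivity : 0 ≤ 2 / r ^ 2)
  have e3 : 2 / r ^ 2 * (-a * c ^ 2 + 2 * a * c * r - a * r ^ 2 / 2) - 2 / r * f r
      = a - (2 * a * c) ^ 2 / (2 * a * r ^ 2) := by
    rw [hc]; field_simp; ring
  have e4 : ε ^ 2 / (2 * a) ≤ (2 * a * c) ^ 2 / (2 * a * r ^ 2) := by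
    have e5 : ε ^ 2 / (2 * a) = (ε * r) ^ 2 / (2 * a * r ^ 2) := by field_simp
    rw [e5]
    gcongr
  linarith
end

section
/- Let N ≥ 1 and R > 0 be real numbers, and let A : (0, R] → ℝ be a nonnegative integrable function such that t ↦ A(t)/t^{N-1} is nonincreasing on (0, R]. Then for all real numbers s, S, r, R' with 0 < s < S ≤ r < R' ≤ R, one has (S^N - s^N)·∫_r^{R'} A(t) dt ≤ (R'^N - r^N)·∫_s^S A(t) dt. -/
/-- Annulus-ratio comparison: if `A ≥ 0` is integrable on `(0, R]` and
`t ↦ A t / t ^ (N-1)` is nonincreasing there, then for `0 < s < S ≤ r < R' ≤ R`,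
`(S^N - s^N) ∫_r^{R'} A ≤ (R'^N - r^N) ∫_s^S A`. -/
theorem annulus_ratio_comparison
    (N R : ℝ) (hN : 1 ≤ N) (hR : 0 < R)
    (A : ℝ → ℝ)
    (hnonneg : ∀ t ∈ Set.Ioc (0:ℝ) R, 0 ≤ A t)
    (hint : IntervalIntegrable A MeasureTheory.volume 0 R)
    (hmono : AntitoneOn (fun t => A t / t ^ (N - 1)) (Set.Ioc (0:ℝ) R)) :
    ∀ s S r R' : ℝ, 0 < s → s < S → S ≤ r → r < R' → R' ≤ R →
      (S ^ N - s ^ N) * ∫ t in r..R', A t ≤ (R' ^ N - r ^ N) * ∫ t in s..S, A t := by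
  intro s S r R' hs hsS hSr hrR hR'
  have hr : 0 < r := by linarith
  have hN0 : 0 < N := by linarith
  have hmem : r ∈ Set.Ioc (0:ℝ) R := ⟨hr, by linarith⟩
  set c : ℝ := A r / r ^ (N - 1) with hc
  have hsub : ∀ a b : ℝ, 0 < a → a ≤ b → b ≤ R →
      IntervalIntegrable A MeasureTheory.volume a b := by
    intro a b ha hab hb
    apply hint.mono_set
    rw [Set.uIcc_of_le hab, Set.uIcc_of_le hR.le]
    exact Set.Icc_subset_Icc ha.le hb
  have hpi : ∀ a b : ℝ,
      IntervalIntegrable (fun t : ℝ => c * t ^ (N - 1)) MeasureTheory.volume a b := by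
    intro a b
    exact (intervalIntegral.intervalIntegrable_rpow' (by linarith)).const_mul c
  have hpow : ∀ a b : ℝ, ∫ t in a..b, c * t ^ (N - 1) = c * ((b ^ N - a ^ N) / N) := by
    intro a b
    rw [intervalIntegral.integral_const_mul, integral_rpow (Or.inl (by linarith))]
    simp
  have h1 : ∫ t in r..R', A t ≤ c * ((R' ^ N - r ^ N) / N) := by
    rw [← hpow]
    apply intervalIntegral.integral_mono_on hrR.le (hsub _ _ hr hrR.le hR') (hpi _ _)
    intro t ht
    have ht0 : 0 < t := lt_of_lt_of_le hr ht.1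
    have := hmono hmem ⟨ht0, ht.2.trans hR'⟩ ht.1
    exact (div_le_iff₀ (Real.rpow_pos_of_pos ht0 _)).1 this
  have h2 : c * ((S ^ N - s ^ N) / N) ≤ ∫ t in s..S, A t := by
    rw [← hpow]
    apply intervalIntegral.integral_mono_on hsS.le (hpi _ _) (hsub _ _ hs hsS.le (by linarith))
    intro t ht
    have ht0 : 0 < t := lt_of_lt_of_le hs ht.1
    have htr : t ≤ r := ht.2.trans hSr
    have := hmono ⟨ht0, htr.trans hmem.2⟩ hmem htr
    exact (le_div_iff₀ (Real.rpow_pos_of_pos ht0 _)).1 this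
  have h3 : 0 ≤ S ^ N - s ^ N := sub_nonneg.2 (Real.rpow_le_rpow hs.le hsS.le hN0.le)
  have h4 : 0 ≤ R' ^ N - r ^ N := sub_nonneg.2 (Real.rpow_le_rpow hr.le hrR.le hN0.le)
  calc _ ≤ (S ^ N - s ^ N) * (c * ((R' ^ N - r ^ N) / N)) := mul_le_mul_of_nonneg_left h1 h3
    _ = (R' ^ N - r ^ N) * (c * ((S ^ N - s ^ N) / N)) := by ring
    _ ≤ _ := mul_le_mul_of_nonneg_left h2 h4
end

section
/- Let n ≥ 1 and ā ≥ 0 be real numbers, let R > 0, and let A : (0, R] → ℝ be a positive differentiable integrable function satisfying A'(t) ≤ (ā + (n-1)/t)·A(t) for all t ∈ (0, R]. Set N = n + āR. Then: (i) for all 0 < s < S ≤ r < R' ≤ R, (S^N - s^N)·∫_r^{R'} A(t) dt ≤ (R'^N - r^N)·∫_s^S A(t) dt; and (ii) for all 0 < r < R' ≤ R, r^N·∫₀^{R'} A(t) dt ≤ R'^N·∫₀^r A(t) dt. -/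
/-- One-dimensional analytic core of the improved f-volume comparison theorem:
with `N = n + abar R`, both the annulus and ball comparisons hold for a positive
differentiable integrable `A` with `A' t ≤ (abar + (n-1)/t) A t` on `(0, R]`. -/
theorem volume_comparison_core
    (n abar R : ℝ) (hn : 1 ≤ n) (habar : 0 ≤ abar) (hR : 0 < R)
    (A A' : ℝ → ℝ)
    (hpos : ∀ t ∈ Set.Ioc (0:ℝ) R, 0 < A t)
    (hderiv : ∀ t ∈ Set.Ioc (0:ℝ) R, HasDerivAt A (A' t) t)
    (hint : IntervalIntegrable A MeasureTheory.volume 0 R)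
    (hineq : ∀ t ∈ Set.Ioc (0:ℝ) R, A' t ≤ (abar + (n - 1) / t) * A t) :
    (∀ s S r R' : ℝ, 0 < s → s < S → S ≤ r → r < R' → R' ≤ R →
        (S ^ (n + abar * R) - s ^ (n + abar * R)) * ∫ t in r..R', A t ≤
          (R' ^ (n + abar * R) - r ^ (n + abar * R)) * ∫ t in s..S, A t) ∧
      ∀ r R' : ℝ, 0 < r → r < R' → R' ≤ R →
        r ^ (n + abar * R) * ∫ t in (0:ℝ)..R', A t ≤
          R' ^ (n + abar * R) * ∫ t in (0:ℝ)..r, A t := by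
  set p : ℝ := n + abar * R - 1 with hp
  have hp0 : 0 ≤ p := by nlinarith [mul_nonneg habar hR.le]
  have hN : n + abar * R = p + 1 := by rw [hp]; ring
  rw [hN]
  have hd : ∀ t ∈ Set.Ioc (0:ℝ) R,
      HasDerivAt (fun x => A x * x ^ (-p)) (A' t * t ^ (-p) + A t * (-p * t ^ (-p - 1))) t := by
    intro t ht
    exact (hderiv t ht).mul (Real.hasDerivAt_rpow_const (Or.inl ht.1.ne'))
  have hanti : AntitoneOn (fun x => A x * x ^ (-p)) (Set.Ioc (0:ℝ) R) := by
    apply antitoneOn_of_deriv_nonpos (convex_Ioc 0 R)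
    · exact fun t ht => (hd t ht).continuousAt.continuousWithinAt
    · intro t ht
      exact (hd t (interior_subset ht)).differentiableAt.differentiableWithinAt
    · intro t ht
      have ht' := interior_subset ht
      rw [(hd t ht').deriv]
      have h0 := ht'.1
      have e : t ^ (-p) = t ^ (-p - 1) * t := by
        rw [← Real.rpow_add_one h0.ne']; ring_nf
      rw [e]
      have h1 : 0 < t ^ (-p - 1) := Real.rpow_pos_of_pos h0 _
      have h2 : A' t * t ≤ p * A t := by
        calc A' t * t ≤ ((abar + (n - 1) / t) * A t) * t :=
              mul_le_mul_of_nonneg_right (hineq t ht') h0.le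
          _ = (abar * t + n - 1) * A t := by field_simp; ring
          _ ≤ p * A t := by
              apply mul_le_mul_of_nonneg_right _ (hpos t ht').le
              have := mul_le_mul_of_nonneg_left ht'.2 habar
              rw [hp]; linarith
      nlinarith
  have hcmp : ∀ x ∈ Set.Ioc (0:ℝ) R, ∀ y ∈ Set.Ioc (0:ℝ) R, x ≤ y →
      (A y * y ^ (-p)) * x ^ p ≤ A x ∧ A y ≤ (A x * x ^ (-p)) * y ^ p := by
    intro x hx y hy hxy
    have h := hanti hx hy hxy
    simp only at h
    have k : ∀ z : ℝ, 0 < z → A z * z ^ (-p) * z ^ p = A z := by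
      intro z hz
      rw [mul_assoc, ← Real.rpow_add hz]; simp
    constructor
    · rw [← k x hx.1]
      exact (mul_le_mul_of_nonneg_right h (Real.rpow_nonneg hx.1.le _)).trans_eq (by simp only [k x hx.1])
    · have := mul_le_mul_of_nonneg_right h (Real.rpow_nonneg hy.1.le p)
      rwa [k y hy.1] at this
  have hii : ∀ a b : ℝ, 0 ≤ a → a ≤ b → b ≤ R →
      IntervalIntegrable A MeasureTheory.volume a b := by
    intro a b ha hab hb
    apply hint.mono_set
    rw [Set.uIcc_of_le hab, Set.uIcc_of_le hR.le]
    exact Set.Icc_subset_Icc ha hb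
  have hpi : ∀ c a b : ℝ, IntervalIntegrable (fun t => c * t ^ p) MeasureTheory.volume a b :=
    fun c a b => (intervalIntegral.intervalIntegrable_rpow (Or.inl hp0)).const_mul c
  have hpe : ∀ c a b : ℝ, ∫ t in a..b, c * t ^ p = c * ((b ^ (p + 1) - a ^ (p + 1)) / (p + 1)) := by
    intro c a b
    rw [intervalIntegral.integral_const_mul, integral_rpow (Or.inl (by linarith))]
  have main : ∀ s S r R' : ℝ, 0 ≤ s → s < S → S ≤ r → r < R' → R' ≤ R →
        (S ^ (p + 1) - s ^ (p + 1)) * ∫ t in r..R', A t ≤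
          (R' ^ (p + 1) - r ^ (p + 1)) * ∫ t in s..S, A t := by
    intro s S r R' hs hsS hSr hrR hRR
    have hS0 : 0 < S := hs.trans_lt hsS
    have hSm : S ∈ Set.Ioc (0:ℝ) R := ⟨hS0, by linarith⟩
    have l1 : ∫ t in s..S, (A S * S ^ (-p)) * t ^ p ≤ ∫ t in s..S, A t := by
      apply intervalIntegral.integral_mono_on_of_le_Ioo hsS.le (hpi _ _ _)
        (hii _ _ hs hsS.le hSm.2)
      intro t ht
      exact (hcmp t ⟨by linarith [ht.1], by linarith [ht.2, hSm.2]⟩ S hSm ht.2.le).1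
    have l2 : ∫ t in r..R', A t ≤ ∫ t in r..R', (A S * S ^ (-p)) * t ^ p := by
      apply intervalIntegral.integral_mono_on_of_le_Ioo hrR.le
        (hii _ _ (by linarith) hrR.le hRR) (hpi _ _ _)
      intro t ht
      exact (hcmp S hSm t ⟨by linarith [ht.1], by linarith [ht.2]⟩ (by linarith [ht.1])).2
    rw [hpe] at l1 l2
    have m1 : 0 ≤ S ^ (p + 1) - s ^ (p + 1) :=
      sub_nonneg.2 (Real.rpow_le_rpow hs hsS.le (by linarith))
    have m2 : 0 ≤ R' ^ (p + 1) - r ^ (p + 1) :=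
      sub_nonneg.2 (Real.rpow_le_rpow (by linarith) hrR.le (by linarith))
    refine (mul_le_mul_of_nonneg_left l2 m1).trans
      (le_trans (le_of_eq ?_) (mul_le_mul_of_nonneg_left l1 m2))
    ring
  refine ⟨fun s S r R' hs => main s S r R' hs.le, ?_⟩
  intro r R' hr hrR hRR
  have h := main 0 r r R' le_rfl hr le_rfl hrR hRR
  rw [Real.zero_rpow (by linarith)] at h
  rw [← intervalIntegral.integral_add_adjacent_intervals
    (hii 0 r le_rfl hr.le (by linarith)) (hii r R' hr.le hrR.le hRR)]
  linarith
end
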